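/- Proposition 4.7: Let 𝒳 be a Polish space and ℋ a measurable concept class with |ℋ| > 2. The following are equivalent: (1) ℋ is learnable at rate e^{-n} but not at any faster rate (i.e., ℋ is learnable with optimal rate e^{-n}); (2) ℋ does not have an infinite Littlestone tree; (3) there is a learning algorithm ĥ_n such that for every realizable distribution P, P{er_P(ĥ_n) > 0} → 0 as n → ∞; (4) there is a learning algorithm ĥ_n such that for every realizable distribution P there exist C, c > 0 with P{er_P(ĥ_n) > 0} ≤ C·e^{-c·n} for all n. -/

import Mathlib

open scoped ENNReal

/-- A function is universally measurable if it is measurable with respect to (the completion of)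
every Borel probability measure on its domain. -/
def UniversallyMeasurable {α β : Type*} [MeasurableSpace α] [MeasurableSpace β] (f : α → β) : Prop :=
  ∀ μ : MeasureTheory.Measure α, MeasureTheory.IsProbabilityMeasure μ →
    MeasureTheory.NullMeasurable f μ

variable {𝒳 : Type*}

/-- The error of a classifier `h` under distribution `P` on `𝒳 × {0,1}`. -/
noncomputable def errP [MeasurableSpace 𝒳] (P : MeasureTheory.Measure (𝒳 × Bool))
    (h : 𝒳 → Bool) : ℝ≥0∞ :=
  P {p : 𝒳 × Bool | h p.1 ≠ p.2}

/-- `P` is realizable w.r.t. the concept class `ℋ`: `inf_{h ∈ ℋ} er_P(h) = 0`. -/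
def Realizable [MeasurableSpace 𝒳] (ℋ : Set (𝒳 → Bool))
    (P : MeasureTheory.Measure (𝒳 × Bool)) : Prop :=
  (⨅ h ∈ ℋ, errP P h) = 0

/-- A learning algorithm: a sequence of universally measurable maps
`H_n : (𝒳 × {0,1})^n × 𝒳 → {0,1}`. -/
structure LearningAlgorithm (𝒳 : Type*) [MeasurableSpace 𝒳] where
  H : ∀ n : ℕ, (Fin n → 𝒳 × Bool) → 𝒳 → Bool
  meas : ∀ n : ℕ, UniversallyMeasurable fun q : (Fin n → 𝒳 × Bool) × 𝒳 => H n q.1 q.2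

/-- Expected error `E[er_P(ĥ_n)]` of the output of a learning algorithm on an i.i.d. sample of
size `n` from `P`, i.e. integration with respect to `P^{⊗n}`. -/
noncomputable def expErr [MeasurableSpace 𝒳] (P : MeasureTheory.Measure (𝒳 × Bool))
    (A : LearningAlgorithm 𝒳) (n : ℕ) : ℝ≥0∞ :=
  MeasureTheory.lintegral (MeasureTheory.Measure.pi fun _ : Fin n => P)
    fun s => errP P (A.H n s)

/-- A rate function: `R : ℕ → [0,1]` with `R(n) → 0`. -/
def IsRate (R : ℕ → ℝ) : Prop :=
  (∀ n, R n ∈ Set.Icc (0 : ℝ) 1) ∧ Filter.Tendsto R Filter.atTop (nhds 0)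

/-- `ℋ` is learnable at rate `R`. -/
def LearnableAtRate [MeasurableSpace 𝒳] (ℋ : Set (𝒳 → Bool)) (R : ℕ → ℝ) : Prop :=
  ∃ A : LearningAlgorithm 𝒳,
    ∀ P : MeasureTheory.Measure (𝒳 × Bool),
      MeasureTheory.IsProbabilityMeasure P → Realizable ℋ P →
        ∃ C > (0 : ℝ), ∃ c > (0 : ℝ), ∀ n : ℕ,
          expErr P A n ≤ ENNReal.ofReal (C * R ⌈c * (n : ℝ)⌉₊)

/-- `ℋ` is not learnable at rate faster than `R`. -/
def NotLearnableFasterThan [MeasurableSpace 𝒳] (ℋ : Set (𝒳 → Bool)) (R : ℕ → ℝ) : Prop :=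
  ∀ A : LearningAlgorithm 𝒳,
    ∃ P : MeasureTheory.Measure (𝒳 × Bool),
      MeasureTheory.IsProbabilityMeasure P ∧ Realizable ℋ P ∧
        ∃ C > (0 : ℝ), ∃ c > (0 : ℝ),
          {n : ℕ | ENNReal.ofReal (C * R ⌈c * (n : ℝ)⌉₊) ≤ expErr P A n}.Infinite

/-- `ℋ` is learnable with optimal rate `R`. -/
def LearnableWithOptimalRate [MeasurableSpace 𝒳] (ℋ : Set (𝒳 → Bool)) (R : ℕ → ℝ) : Prop :=
  LearnableAtRate ℋ R ∧ NotLearnableFasterThan ℋ R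

/-- `ℋ` requires arbitrarily slow rates. -/
def RequiresArbitrarilySlowRates [MeasurableSpace 𝒳] (ℋ : Set (𝒳 → Bool)) : Prop :=
  ∀ R : ℕ → ℝ, IsRate R → NotLearnableFasterThan ℋ R

/-- Witness that `ℋ` is a measurable class: it is parameterized by a Polish space `Θ` via a
Borel measurable map `𝗁 : Θ × 𝒳 → {0,1}`. -/
structure MeasurableClassWitness (𝒳 : Type*) [MeasurableSpace 𝒳] (ℋ : Set (𝒳 → Bool)) where
  Θ : Type
  [tΘ : TopologicalSpace Θ]
  [mΘ : MeasurableSpace Θ]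
  [polish : PolishSpace Θ]
  [borel : BorelSpace Θ]
  f : Θ → 𝒳 → Bool
  meas : Measurable (Function.uncurry f)
  range_eq : ℋ = Set.range f

/-- `ℋ` is a measurable class (image admissible Suslin). -/
def MeasurableClass (𝒳 : Type*) [MeasurableSpace 𝒳] (ℋ : Set (𝒳 → Bool)) : Prop :=
  Nonempty (MeasurableClassWitness 𝒳 ℋ)

/-- `ℋ` has an infinite Littlestone tree: nodes are indexed by finite binary strings, and every
finite branch is consistent with some concept in `ℋ`. -/
def HasInfiniteLittlestoneTree (ℋ : Set (𝒳 → Bool)) : Prop :=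
  ∃ x : List Bool → 𝒳, ∀ (y : ℕ → Bool) (n : ℕ),
    ∃ h ∈ ℋ, ∀ k ≤ n, h (x (List.ofFn fun i : Fin k => y i)) = y k

/-- `ℋ` has an infinite VCL tree: the node at depth `k` along a branch is a `(k+1)`-tuple of
points, edges out of it are labelled by `{0,1}^{k+1}`, and every finite branch is consistent
with some concept in `ℋ`. -/
def HasInfiniteVCLTree (ℋ : Set (𝒳 → Bool)) : Prop :=
  ∃ x : ∀ k : ℕ, (∀ j : Fin k, Fin (j.val + 1) → Bool) → Fin (k + 1) → 𝒳,
    ∀ (y : ∀ k : ℕ, Fin (k + 1) → Bool) (n : ℕ),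
      ∃ h ∈ ℋ, ∀ k ≤ n, ∀ i : Fin (k + 1),
        h (x k (fun j => y j.val) i) = y k i

section Analytic

open MeasureTheory Set TopologicalSpace Filter Topology

theorem isCompact_setOf_forall_le (k : ℕ → ℕ) :
    IsCompact {x : ℕ → ℕ | ∀ i, x i ≤ k i} := by
  convert isCompact_univ_pi fun i => (finite_Iic (k i)).isCompact using 1
  ext x
  simp [Pi.le_def]

theorem exists_bounded_cylinders_subset {k : ℕ → ℕ} {V : Set (ℕ → ℕ)} (hV : IsOpen V)
    (hK : {x : ℕ → ℕ | ∀ i, x i ≤ k i} ⊆ V) : ∃ n, {x : ℕ → ℕ | ∀ i < n, x i ≤ k i} ⊆ V := by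
  let : MetricSpace (ℕ → ℕ) := PiNat.metricSpaceNatNat
  obtain ⟨δ, hδ, hsub⟩ := (isCompact_setOf_forall_le k).exists_thickening_subset_open hV hK
  obtain ⟨n, hn⟩ := exists_pow_lt_of_lt_one hδ (show (1 / 2 : ℝ) < 1 by norm_num)
  refine ⟨n, fun x hx => hsub (Metric.mem_thickening_iff.2 ⟨fun i => min (x i) (k i), ?_, ?_⟩)⟩
  · exact fun i => min_le_right _ _
  · refine lt_of_le_of_lt (PiNat.mem_cylinder_iff_dist_le.1 ?_) hn
    intro i hi
    exact (min_eq_left (hx i hi)).symm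

/-- The image of the Baire space under a continuous map can be approximated in outer measure by
compact subsets. -/
theorem exists_isCompact_subset_range_measure_ge {α : Type*} [TopologicalSpace α]
    [MeasurableSpace α] (μ : Measure α) [μ.OuterRegular]
    {f : (ℕ → ℕ) → α} (hf : Continuous f) {t : ℝ≥0∞} (ht : t < μ (range f)) :
    ∃ K ⊆ range f, IsCompact K ∧ t ≤ μ K := by
  have step : ∀ (n : ℕ) (C : Set (ℕ → ℕ)), t < μ (f '' C) →
      ∃ j : ℕ, t < μ (f '' (C ∩ {x | x n ≤ j})) := by
    intro n C hC
    have hmono : Monotone fun j : ℕ => f '' (C ∩ {x | x n ≤ j}) := fun a b hab =>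
      image_mono (inter_subset_inter_right _ fun x (hx : x n ≤ a) => hx.trans hab)
    have hU : f '' C = ⋃ j : ℕ, f '' (C ∩ {x | x n ≤ j}) := by
      rw [← image_iUnion, ← inter_iUnion]
      congr 1
      ext x
      simpa using fun _ => ⟨x n, le_rfl⟩
    rw [hU, hmono.measure_iUnion] at hC
    exact lt_iSup_iff.1 hC
  choose! j hj using step
  let C : ℕ → Set (ℕ → ℕ) := fun n => Nat.rec univ (fun n C => C ∩ {x | x n ≤ j n C}) n
  have hC : ∀ n, t < μ (f '' C n) := by
    intro n
    induction n with
    | zero => simpa [C] using ht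
    | succ n ih => exact hj n _ ih
  let k : ℕ → ℕ := fun n => j n (C n)
  have hCk : ∀ n, C n = {x : ℕ → ℕ | ∀ i < n, x i ≤ k i} := by
    intro n
    induction n with
    | zero => simp [C]
    | succ n ih =>
      have : C (n + 1) = C n ∩ {x | x n ≤ k n} := rfl
      rw [this, ih]
      ext x
      simp [Nat.le_iff_lt_or_eq, or_imp, forall_and]
  refine ⟨f '' {x | ∀ i, x i ≤ k i}, image_subset_range _ _, (isCompact_setOf_forall_le k).image hf, ?_⟩
  rw [Set.measure_eq_iInf_isOpen]
  refine le_iInf fun U => le_iInf fun hU => le_iInf fun hUo => ?_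
  obtain ⟨n, hn⟩ := exists_bounded_cylinders_subset (hUo.preimage hf) (image_subset_iff.1 hU)
  rw [← hCk] at hn
  exact (hC n).le.trans (measure_mono (image_subset_iff.2 hn))

/-- Analytic sets are universally measurable. -/
theorem MeasureTheory.AnalyticSet.nullMeasurableSet {α : Type*} [TopologicalSpace α]
    [PolishSpace α] [MeasurableSpace α] [BorelSpace α] {s : Set α} (hs : AnalyticSet s)
    (μ : Measure α) [IsFiniteMeasure μ] : NullMeasurableSet s μ := by
  let := upgradeIsCompletelyMetrizable α
  rw [AnalyticSet] at hs
  obtain rfl | ⟨f, hf, rfl⟩ := hs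
  · exact nullMeasurableSet_empty
  rcases eq_or_ne (μ (range f)) 0 with h0 | h0
  · exact NullMeasurableSet.of_null h0
  obtain ⟨u, -, hu, hlim⟩ := exists_seq_strictMono_tendsto' (pos_iff_ne_zero.2 h0)
  choose K hKs hKc hK using fun n =>
    exists_isCompact_subset_range_measure_ge μ hf (hu n).2
  have hm : MeasurableSet (⋃ n, K n) := MeasurableSet.iUnion fun n => (hKc n).isClosed.measurableSet
  have hle : μ (range f) ≤ μ (⋃ n, K n) :=
    le_of_tendsto' hlim fun n => (hK n).trans (measure_mono (subset_iUnion K n))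
  exact hm.nullMeasurableSet.congr (ae_eq_of_subset_of_measure_ge (iUnion_subset hKs) hle
    hm.nullMeasurableSet (measure_ne_top _ _))

end Analytic

section Tower

open MeasureTheory Set Filter Topology Ordinal
open scoped Cardinal

theorem exists_agreeing_of_forall_lt_omega_one {Z : Type*} {g : ℕ → (ℕ → ℕ) → Z}
    {E : ℕ → Set (Z × Z)} {L : Ordinal.{0} → ℕ → Z → Prop}
    (anti : ∀ α β n z, α ≤ β → L β n z → L α n z)
    (hs : ∀ α β n z, α < β → L β n z → ∃ z', (z, z') ∈ E n ∧ L α (n + 1) z')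
    (hg : ∀ α n z, L α n z → z ∈ range (g n)) (n : ℕ) (v : ℕ → ℕ → ℕ)
    (hv : ∀ α < ω₁, ∃ c : ℕ → ℕ → ℕ, (∀ i < n, (g i (c i), g (i + 1) (c (i + 1))) ∈ E i) ∧
      L α n (g n (c n)) ∧ ∀ i < n, ∀ j < n, c i j = v i j) :
    ∃ v' : ℕ → ℕ → ℕ, (∀ i < n, ∀ j < n, v' i j = v i j) ∧
      ∀ α < ω₁, ∃ c : ℕ → ℕ → ℕ, (∀ i < n + 1, (g i (c i), g (i + 1) (c (i + 1))) ∈ E i) ∧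
        L α (n + 1) (g (n + 1) (c (n + 1))) ∧ ∀ i < n + 1, ∀ j < n + 1, c i j = v' i j := by
  have hext : ∀ α < ω₁, ∃ c : ℕ → ℕ → ℕ, (∀ i < n + 1, (g i (c i), g (i + 1) (c (i + 1))) ∈ E i) ∧
      L α (n + 1) (g (n + 1) (c (n + 1))) ∧ ∀ i < n, ∀ j < n, c i j = v i j := by
    intro α hα
    obtain ⟨c, hc, hL, hcv⟩ := hv (Order.succ α) ((Cardinal.isSuccLimit_omega 1).succ_lt hα)
    obtain ⟨z', hz', hL'⟩ := hs α _ n _ (Order.lt_succ α) hL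
    obtain ⟨d, rfl⟩ := hg _ _ _ hL'
    refine ⟨Function.update c (n + 1) d, ?_, by simpa using hL', ?_⟩
    · intro i hi
      rw [Function.update_of_ne (by omega)]
      rcases Nat.lt_succ_iff_lt_or_eq.1 hi with h | rfl
      · rw [Function.update_of_ne (by omega)]
        exact hc i h
      · simpa using hz'
    · intro i hi j hj
      rw [Function.update_of_ne (by omega)]
      exact hcv i hi j hj
  by_contra! hcon
  let ext : (Fin (n + 1) → Fin (n + 1) → ℕ) → ℕ → ℕ → ℕ := fun w i j =>
    if h : i < n + 1 ∧ j < n + 1 then w ⟨i, h.1⟩ ⟨j, h.2⟩ else 0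
  have hw : ∀ w, ∃ α < ω₁, (∀ i < n, ∀ j < n, ext w i j = v i j) →
      ∀ c : ℕ → ℕ → ℕ, (∀ i < n + 1, (g i (c i), g (i + 1) (c (i + 1))) ∈ E i) →
        L α (n + 1) (g (n + 1) (c (n + 1))) → ∃ i < n + 1, ∃ j < n + 1, c i j ≠ ext w i j := by
    intro w
    by_cases h : ∀ i < n, ∀ j < n, ext w i j = v i j
    · obtain ⟨α, hα, h'⟩ := hcon _ h
      exact ⟨α, hα, fun _ => h'⟩
    · exact ⟨0, omega_pos 1, fun h' => absurd h' h⟩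
  choose a ha hw using hw
  obtain ⟨c, hc, hL, hcv⟩ := hext (⨆ w, a w) (iSup_lt_omega_one ha)
  let w : Fin (n + 1) → Fin (n + 1) → ℕ := fun i j => c i j
  have hcw : ∀ i < n + 1, ∀ j < n + 1, c i j = ext w i j := by
    intro i hi j hj
    simp [ext, w, Nat.lt_succ_iff.1 hi, Nat.lt_succ_iff.1 hj]
  obtain ⟨i, hi, j, hj, hne⟩ := hw w
    (fun i hi j hj => (hcw i (by omega) j (by omega)).symm.trans (hcv i hi j hj)) c hc
    (anti _ _ _ _ (Ordinal.le_iSup a w) hL)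
  exact hne (hcw i hi j hj)

/-- A boundedness principle of Kunen–Martin type: a tree whose levels are analytic sets, with closed
successor relations, and which has nodes of every countable rank has an infinite branch. -/
theorem exists_branch_of_forall_lt_omega_one {Z : Type*} [TopologicalSpace Z]
    {A : ℕ → Set Z} (hA : ∀ n, AnalyticSet (A n)) {E : ℕ → Set (Z × Z)} (hE : ∀ n, IsClosed (E n))
    {L : Ordinal.{0} → ℕ → Z → Prop}
    (anti : ∀ α β n z, α ≤ β → L β n z → L α n z)
    (h0 : ∀ α < ω₁, ∃ z, L α 0 z)
    (hs : ∀ α β n z, α < β → L β n z → ∃ z', (z, z') ∈ E n ∧ L α (n + 1) z')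
    (hLA : ∀ α n z, L α n z → z ∈ A n) :
    ∃ z : ℕ → Z, ∀ n, z n ∈ A n ∧ (z n, z (n + 1)) ∈ E n := by
  have hne : ∀ n, ∀ α < ω₁, ∃ z, L α n z := by
    intro n
    induction n with
    | zero => exact h0
    | succ n ih =>
      intro α hα
      obtain ⟨z, hz⟩ := ih (Order.succ α) ((Cardinal.isSuccLimit_omega 1).succ_lt hα)
      obtain ⟨z', -, hz'⟩ := hs α _ n _ (Order.lt_succ α) hz
      exact ⟨z', hz'⟩
  have hg : ∀ n, ∃ g : (ℕ → ℕ) → Z, Continuous g ∧ range g = A n := by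
    intro n
    have h := hA n
    rw [AnalyticSet] at h
    refine h.resolve_left fun h => ?_
    obtain ⟨z, hz⟩ := hne n 0 (omega_pos 1)
    simpa [h] using hLA _ _ _ hz
  choose g hgc hgr using hg
  have hLg : ∀ α n z, L α n z → z ∈ range (g n) := fun α n z h => by
    rw [hgr]
    exact hLA _ _ _ h
  let Good : ℕ → (ℕ → ℕ → ℕ) → Prop := fun n v => ∀ α < ω₁, ∃ c : ℕ → ℕ → ℕ,
    (∀ i < n, (g i (c i), g (i + 1) (c (i + 1))) ∈ E i) ∧
      L α n (g n (c n)) ∧ ∀ i < n, ∀ j < n, c i j = v i j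
  have hstep : ∀ n v, Good n v → ∃ v', (∀ i < n, ∀ j < n, v' i j = v i j) ∧ Good (n + 1) v' :=
    exists_agreeing_of_forall_lt_omega_one anti hs hLg
  choose! next hagree hgood using hstep
  let v : ℕ → ℕ → ℕ → ℕ := fun n => Nat.rec (fun _ _ => 0) next n
  have hvgood : ∀ n, Good n (v n) := by
    intro n
    induction n with
    | zero =>
      intro α hα
      obtain ⟨z, hz⟩ := h0 α hα
      obtain ⟨d, rfl⟩ := hLg _ _ _ hz
      exact ⟨fun _ => d, by simp, hz, by simp⟩
    | succ n ih => exact hgood n _ ih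
  have hv_le : ∀ m n, n ≤ m → ∀ i < n, ∀ j < n, v m i j = v n i j := by
    intro m n hnm
    induction hnm with
    | refl => simp
    | step hnm ih =>
      intro i hi j hj
      rw [← ih i hi j hj]
      exact hagree _ _ (hvgood _) i (lt_of_lt_of_le hi hnm) j (lt_of_lt_of_le hj hnm)
  let cl : ℕ → ℕ → ℕ := fun i j => v (max i j + 1) i j
  choose c hc _ hcv using fun n => hvgood n 0 (omega_pos 1)
  have hlim : ∀ i, Tendsto (fun n => c n i) atTop (𝓝 (cl i)) := by
    intro i
    rw [tendsto_pi_nhds]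
    intro j
    refine tendsto_const_nhds.congr' ?_
    filter_upwards [eventually_ge_atTop (max i j + 1)] with n hn
    rw [hcv n i (by omega) j (by omega)]
    exact (hv_le n _ hn i (by omega) j (by omega)).symm
  refine ⟨fun n => g n (cl n), fun n => ⟨hgr n ▸ mem_range_self _, ?_⟩⟩
  refine (hE n).mem_of_tendsto ((((hgc n).tendsto _).comp (hlim n)).prodMk_nhds
    (((hgc (n + 1)).tendsto _).comp (hlim (n + 1)))) ?_
  filter_upwards [eventually_gt_atTop n] with m hm
  exact hc m n hm

end Tower

section LittlestoneRank

open MeasureTheory Set Ordinal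

universe u

/-- `LittlestoneRankGE f α V` says that the ordinal Littlestone dimension of the concept class
parameterized by `V` is at least `α`. -/
def LittlestoneRankGE {Θ X : Type*} (f : Θ → X → Bool) (α : Ordinal.{0}) (V : Set Θ) : Prop :=
  V.Nonempty ∧ ∀ β < α, ∃ x, ∀ b, LittlestoneRankGE f β (V ∩ {θ | f θ x = b})
termination_by α

namespace LittlestoneRankGE

variable {Θ X : Type*} {f : Θ → X → Bool} {α β : Ordinal.{0}} {V W : Set Θ}

theorem nonempty (h : LittlestoneRankGE f α V) : V.Nonempty := by
  rw [LittlestoneRankGE] at h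
  exact h.1

theorem anti (h : LittlestoneRankGE f β V) (hαβ : α ≤ β) : LittlestoneRankGE f α V := by
  rw [LittlestoneRankGE] at h ⊢
  exact ⟨h.1, fun γ hγ => h.2 γ (hγ.trans_le hαβ)⟩

theorem mono (h : LittlestoneRankGE f α V) (hVW : V ⊆ W) : LittlestoneRankGE f α W := by
  induction α using WellFoundedLT.induction generalizing V W with
  | ind α ih =>
    rw [LittlestoneRankGE] at h ⊢
    refine ⟨h.1.mono hVW, fun γ hγ => ?_⟩
    obtain ⟨x, hx⟩ := h.2 γ hγ
    exact ⟨x, fun b => ih γ hγ (hx b) (inter_subset_inter_left _ hVW)⟩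

end LittlestoneRankGE

theorem Ordinal.countable_Iio_of_lt_omega_one {α : Ordinal.{0}} (h : α < ω₁) :
    Countable (Iio α) := by
  rw [← Cardinal.mk_le_aleph0_iff, Cardinal.mk_Iio_ordinal, Cardinal.lift_le_aleph0,
    ← Order.lt_succ_iff, Cardinal.succ_aleph0, ← Cardinal.lt_ord, Cardinal.ord_aleph]
  exact h

theorem analyticSet_setOf_littlestoneRankGE {Θ : Type*} {X : Type u}
    [TopologicalSpace Θ] [PolishSpace Θ] [MeasurableSpace Θ] [BorelSpace Θ]
    [TopologicalSpace X] [PolishSpace X] [MeasurableSpace X] [BorelSpace X]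
    {f : Θ → X → Bool} (hf : Measurable (Function.uncurry f)) {α : Ordinal.{0}} (hα : α < ω₁)
    (Y : Type u) [TopologicalSpace Y] [PolishSpace Y] [MeasurableSpace Y] [BorelSpace Y]
    {D : Set (Y × Θ)} (hD : MeasurableSet D) :
    AnalyticSet {y | LittlestoneRankGE f α {θ | (y, θ) ∈ D}} := by
  induction α using WellFoundedLT.induction generalizing Y with
  | ind α ih =>
    have hbase : AnalyticSet {y | {θ | (y, θ) ∈ D}.Nonempty} := by
      convert hD.analyticSet.image_of_continuous continuous_fst using 1
      ext y
      simp [Set.Nonempty]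
    have hstep : ∀ β < α, AnalyticSet
        {y | ∃ x, ∀ b, LittlestoneRankGE f β ({θ | (y, θ) ∈ D} ∩ {θ | f θ x = b})} := by
      intro β hβ
      have hA : AnalyticSet (⋂ b : Bool, {q : Y × X |
          LittlestoneRankGE f β {θ | (q, θ) ∈ {r : (Y × X) × Θ | (r.1.1, r.2) ∈ D ∧
            f r.2 r.1.2 = b}}}) := by
        refine AnalyticSet.iInter fun b => ih β hβ (hβ.trans hα) (Y × X) ?_
        refine MeasurableSet.inter (hD.preimage (by fun_prop)) ?_
        exact (hf.comp (show Measurable fun r : (Y × X) × Θ => (r.2, r.1.2) by fun_prop))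
          (measurableSet_singleton b)
      convert hA.image_of_continuous continuous_fst using 1
      ext y
      simp only [mem_ofPred_eq, mem_image, mem_iInter, Prod.exists, exists_and_right, exists_eq_right]
      rfl
    have hset : {y | LittlestoneRankGE f α {θ | (y, θ) ∈ D}} =
        {y | {θ | (y, θ) ∈ D}.Nonempty} ∩ ⋂ β : Iio α,
          {y | ∃ x, ∀ b, LittlestoneRankGE f β ({θ | (y, θ) ∈ D} ∩ {θ | f θ x = b})} := by
      ext y
      rw [mem_ofPred_eq, LittlestoneRankGE]
      simp
    rw [hset]
    have := Ordinal.countable_Iio_of_lt_omega_one hα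
    rw [show ∀ (s : Set Y) (t : Iio α → Set Y), s ∩ ⋂ β, t β = ⋂ o : Option (Iio α), o.elim s t
      from fun s t => by rw [iInter_option]; rfl]
    refine AnalyticSet.iInter fun o => ?_
    cases o with
    | none => exact hbase
    | some β => exact hstep β β.2

theorem exists_lt_omega_one_not_littlestoneRankGE {Θ X : Type*}
    [TopologicalSpace Θ] [PolishSpace Θ] [MeasurableSpace Θ] [BorelSpace Θ]
    [TopologicalSpace X] [PolishSpace X] [MeasurableSpace X] [BorelSpace X]
    {f : Θ → X → Bool} (hf : Measurable (Function.uncurry f))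
    (hT : ¬ HasInfiniteLittlestoneTree (range f)) :
    ∃ α < ω₁, ¬ LittlestoneRankGE f α univ := by
  by_contra! hcon
  let pre : (ℕ → Bool) → ℕ → List Bool := fun y k => List.ofFn fun i : Fin k => y i
  let V : ℕ → (List Bool → X) → (ℕ → Bool) → Set Θ :=
    fun n x y => {θ | ∀ k < n, f θ (x (pre y k)) = y k}
  have hpre : ∀ {y y' : ℕ → Bool} {n : ℕ}, (∀ i < n, y i = y' i) → ∀ k ≤ n, pre y k = pre y' k := by
    intro y y' n h k hk
    simp only [pre]
    congr 1
    ext i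
    rw [h i (by omega)]
  have hVcongr : ∀ {y y' : ℕ → Bool} {n : ℕ} (x), (∀ i < n, y i = y' i) → V n x y = V n x y' := by
    intro y y' n x h
    ext θ
    refine forall₂_congr fun k hk => ?_
    rw [hpre h k hk.le, h k hk]
  let pad : List Bool → ℕ → Bool := fun u i => u.getD i false
  have hpad : ∀ (y : ℕ → Bool) (n : ℕ), ∀ i < n, pad (pre y n) i = y i := by
    intro y n i hi
    simp [pad, pre, List.getD, hi]
  suffices h : ∃ z : ℕ → List Bool → X, ∀ n, z n ∈ ⋂ u : List Bool, {x | (V n x (pad u)).Nonempty} ∧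
      (z n, z (n + 1)) ∈ ⋂ u : List Bool, {p : (List Bool → X) × (List Bool → X) |
        u.length < n → p.1 u = p.2 u} by
    obtain ⟨z, hz⟩ := h
    have hz_le : ∀ m n, n ≤ m → ∀ u : List Bool, u.length < n → z m u = z n u := by
      intro m n hnm
      induction hnm with
      | refl => simp
      | @step m hnm ih =>
        intro u hu
        rw [← ih u hu]
        exact (mem_iInter.1 (hz m).2 u (hu.trans_le hnm)).symm
    refine hT ⟨fun u => z (u.length + 1) u, fun y n => ?_⟩
    obtain ⟨θ, hθ⟩ := mem_iInter.1 (hz (n + 1)).1 (pre y (n + 1))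
    rw [hVcongr _ (hpad y (n + 1))] at hθ
    refine ⟨f θ, mem_range_self θ, fun k hk => ?_⟩
    have h1 := hθ k (by omega)
    have h2 : (pre y k).length = k := by simp [pre]
    rw [hz_le (n + 1) ((pre y k).length + 1) (by omega) (pre y k) (by omega)] at h1
    exact h1
  refine exists_branch_of_forall_lt_omega_one
    (L := fun α n x => ∀ y, LittlestoneRankGE f α (V n x y)) ?_ ?_ ?_ ?_ ?_ ?_
  · intro n
    refine AnalyticSet.iInter fun u => ?_
    have hm : MeasurableSet {p : (List Bool → X) × Θ | p.2 ∈ V n p.1 (pad u)} := by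
      have : {p : (List Bool → X) × Θ | p.2 ∈ V n p.1 (pad u)} =
          ⋂ k : ℕ, ⋂ _ : k < n, {p | f p.2 (p.1 (pre (pad u) k)) = pad u k} := by
        ext p
        simp [V]
      rw [this]
      refine MeasurableSet.iInter fun k => MeasurableSet.iInter fun _ => ?_
      exact (hf.comp (show Measurable fun p : (List Bool → X) × Θ => (p.2, p.1 (pre (pad u) k)) by
        fun_prop)) (measurableSet_singleton _)
    convert hm.analyticSet.image_of_continuous continuous_fst using 1
    ext x
    simp [Set.Nonempty]
  · intro n
    refine isClosed_iInter fun u => ?_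
    by_cases h : u.length < n
    · simp only [h, true_imp_iff]
      exact isClosed_eq (by fun_prop) (by fun_prop)
    · simp [h]
  · exact fun α β n x hαβ h y => (h y).anti hαβ
  · intro α hα
    have hne := (hcon α hα)
    obtain ⟨x⟩ : Nonempty X := by
      have h1 := hcon 1 (one_lt_omega0.trans omega0_lt_omega_one)
      rw [LittlestoneRankGE] at h1
      obtain ⟨x, -⟩ := h1.2 0 zero_lt_one
      exact ⟨x⟩
    refine ⟨fun _ => x, fun y => ?_⟩
    simpa [V] using hne
  · intro α β n x hαβ h
    have hξ : ∀ y, ∃ ξ, ∀ b, LittlestoneRankGE f α (V n x y ∩ {θ | f θ ξ = b}) := by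
      intro y
      have h' := h y
      rw [LittlestoneRankGE] at h'
      exact h'.2 α hαβ
    choose ξ hξ using hξ
    refine ⟨fun u => if u.length < n then x u else ξ (pad u), ?_, ?_⟩
    · exact mem_iInter.2 fun u hu => by simp [hu]
    · intro y
      convert hξ (pad (pre y n)) (y n) using 1
      rw [hVcongr x (hpad y n)]
      ext θ
      simp only [V, Nat.lt_succ_iff_lt_or_eq, or_imp, forall_and, forall_eq, mem_ofPred_eq,
        mem_inter_iff, pre, List.length_ofFn, lt_irrefl, if_false]
      refine and_congr_left fun _ => forall₂_congr fun k hk => ?_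
      rw [if_pos hk]
  · exact fun α n x h => mem_iInter.2 fun u => (h _).nonempty

open scoped Classical in
/-- The standard optimal algorithm: predict the label whose version space has the larger ordinal
Littlestone dimension, truncated at `β`. -/
noncomputable def soaPredict {Θ X : Type*} (f : Θ → X → Bool) (β : Ordinal.{0}) (V : Set Θ)
    (x : X) : Bool :=
  if ∃ α < β, LittlestoneRankGE f α (V ∩ {θ | f θ x = true}) ∧
    ¬ LittlestoneRankGE f α (V ∩ {θ | f θ x = false}) then true else false

/-- Every mistake of the standard optimal algorithm strictly decreases the ordinal Littlestone
dimension of the version space. -/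
theorem exists_lt_not_littlestoneRankGE_of_soaPredict_ne {Θ X : Type*} {f : Θ → X → Bool}
    {α β : Ordinal.{0}} (hαβ : α ≤ β) {V : Set Θ}
    (hV : V.Nonempty) (hα : ¬ LittlestoneRankGE f α V) {x : X} {b : Bool}
    (hb : soaPredict f β V x ≠ b) :
    ∃ γ < α, ¬ LittlestoneRankGE f γ (V ∩ {θ | f θ x = b}) := by
  by_contra! hcon
  apply hα
  rw [LittlestoneRankGE]
  refine ⟨hV, fun γ hγ => ⟨x, ?_⟩⟩
  cases b with
  | false =>
    simp only [soaPredict, ne_eq, Bool.not_eq_false, Bool.if_false_right, Bool.and_true, decide_eq_true_eq] at hb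
    obtain ⟨δ, -, ht, hf⟩ := hb
    have hδ : α ≤ δ := not_lt.1 fun h => hf (hcon δ h)
    rw [Bool.forall_bool]
    exact ⟨hcon γ hγ, ht.anti (hγ.le.trans hδ)⟩
  | true =>
    simp only [soaPredict, ne_eq, Bool.not_eq_true, Bool.if_false_right, Bool.and_true, decide_eq_false_iff_not] at hb
    push Not at hb
    rw [Bool.forall_bool]
    exact ⟨hb γ (hγ.trans_le hαβ) (hcon γ hγ), hcon γ hγ⟩

end LittlestoneRank

section UpperBound

open MeasureTheory Set Ordinal

/-- The concepts of a parameterized class which are consistent with the sample `s`. -/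
def versionSpace {Θ X : Type*} (f : Θ → X → Bool) {n : ℕ} (s : Fin n → X × Bool) : Set Θ :=
  {θ | ∀ i, f θ (s i).1 = (s i).2}

theorem versionSpace_cons {Θ X : Type*} (f : Θ → X → Bool) {n : ℕ} (z : X × Bool)
    (s : Fin n → X × Bool) :
    versionSpace f (Fin.cons z s : Fin (n + 1) → X × Bool) =
      versionSpace f s ∩ {θ | f θ z.1 = z.2} := by
  ext θ
  simp [versionSpace, Fin.forall_fin_succ, and_comm]

theorem measurableSet_setOf_mem_versionSpace {Θ X : Type*} [MeasurableSpace Θ]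
    [MeasurableSpace X] {f : Θ → X → Bool} (hf : Measurable (Function.uncurry f))
    (n : ℕ) :
    MeasurableSet {p : (Fin n → X × Bool) × Θ | p.2 ∈ versionSpace f p.1} := by
  have : {p : (Fin n → X × Bool) × Θ | p.2 ∈ versionSpace f p.1} =
      ⋂ i, {p | f p.2 (p.1 i).1 = (p.1 i).2} := by
    ext p
    simp [versionSpace]
  rw [this]
  refine MeasurableSet.iInter fun i => ?_
  exact measurableSet_eq_fun
    (hf.comp (show Measurable fun p : (Fin n → X × Bool) × Θ => (p.2, (p.1 i).1) by fun_prop))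
    (by fun_prop)

theorem universallyMeasurable_bool {Y : Type*} [MeasurableSpace Y] {g : Y → Bool}
    (h : ∀ μ : Measure Y, IsProbabilityMeasure μ → NullMeasurableSet {y | g y = true} μ) :
    UniversallyMeasurable g := by
  intro μ hμ t _
  have hg := h μ hμ
  have hpre : g ⁻¹' t = ({y | g y = true} ∩ {_y | true ∈ t}) ∪
      ({y | g y = true}ᶜ ∩ {_y | false ∈ t}) := by
    ext y
    cases hy : g y <;> simp [hy]
  rw [hpre]
  exact (hg.inter (MeasurableSet.const _).nullMeasurableSet).union
    (hg.compl.inter (MeasurableSet.const _).nullMeasurableSet)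

section Measurability

universe u

variable {Θ : Type*} {X : Type u}
  [TopologicalSpace Θ] [PolishSpace Θ] [MeasurableSpace Θ] [BorelSpace Θ]
  [TopologicalSpace X] [PolishSpace X] [MeasurableSpace X] [BorelSpace X]
  {f : Θ → X → Bool}

theorem analyticSet_setOf_littlestoneRankGE_versionSpace (hf : Measurable (Function.uncurry f))
    {α : Ordinal.{0}} (hα : α < ω₁) (n : ℕ) :
    AnalyticSet {s : Fin n → X × Bool | LittlestoneRankGE f α (versionSpace f s)} :=
  analyticSet_setOf_littlestoneRankGE hf hα _ (measurableSet_setOf_mem_versionSpace hf n)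

theorem analyticSet_setOf_littlestoneRankGE_versionSpace_inter
    (hf : Measurable (Function.uncurry f)) {α : Ordinal.{0}} (hα : α < ω₁) (n : ℕ) (b : Bool) :
    AnalyticSet {q : (Fin n → X × Bool) × X |
      LittlestoneRankGE f α (versionSpace f q.1 ∩ {θ | f θ q.2 = b})} := by
  have hD : MeasurableSet {p : ((Fin n → X × Bool) × X) × Θ |
      p.2 ∈ versionSpace f p.1.1 ∩ {θ | f θ p.1.2 = b}} := by
    refine MeasurableSet.inter
      ((measurableSet_setOf_mem_versionSpace hf n).preimage
        (show Measurable fun p : ((Fin n → X × Bool) × X) × Θ => (p.1.1, p.2) by fun_prop)) ?_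
    exact (hf.comp (show Measurable fun p : ((Fin n → X × Bool) × X) × Θ => (p.2, p.1.2) by
      fun_prop)) (measurableSet_singleton b)
  exact analyticSet_setOf_littlestoneRankGE hf hα _ hD

/-- The learning algorithm which applies the standard optimal algorithm to the sample. -/
noncomputable def soaAlgorithm (hf : Measurable (Function.uncurry f)) {β : Ordinal.{0}}
    (hβ : β < ω₁) : LearningAlgorithm X where
  H _ s x := soaPredict f β (versionSpace f s) x
  meas n := by
    refine universallyMeasurable_bool fun μ _ => ?_
    have hset : {q : (Fin n → X × Bool) × X | soaPredict f β (versionSpace f q.1) q.2 = true} =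
        ⋃ α : Iio β,
          {q | LittlestoneRankGE f α (versionSpace f q.1 ∩ {θ | f θ q.2 = true})} \
            {q | LittlestoneRankGE f α (versionSpace f q.1 ∩ {θ | f θ q.2 = false})} := by
      ext q
      simp [soaPredict, and_left_comm]
    have := Ordinal.countable_Iio_of_lt_omega_one hβ
    rw [hset]
    refine NullMeasurableSet.iUnion fun α => NullMeasurableSet.diff ?_ ?_ <;>
      exact (analyticSet_setOf_littlestoneRankGE_versionSpace_inter hf
        (α.2.trans hβ) n _).nullMeasurableSet μ

end Measurability

theorem ae_versionSpace_nonempty {Θ X : Type*} [MeasurableSpace Θ] [MeasurableSpace X]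
    {f : Θ → X → Bool} (hf : Measurable (Function.uncurry f)) {P : Measure (X × Bool)}
    [IsProbabilityMeasure P] (hP : Realizable (range f) P) (n : ℕ) :
    ∀ᵐ s ∂(Measure.pi fun _ : Fin n => P), (versionSpace f s).Nonempty := by
  have hle : ∀ θ, (Measure.pi fun _ : Fin n => P) {s | ¬ (versionSpace f s).Nonempty} ≤
      n * errP P (f θ) := by
    intro θ
    have hm : MeasurableSet {p : X × Bool | f θ p.1 ≠ p.2} :=
      (measurableSet_eq_fun (hf.comp (show Measurable fun p : X × Bool => (θ, p.1) by fun_prop))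
        measurable_snd).compl
    calc (Measure.pi fun _ : Fin n => P) {s | ¬ (versionSpace f s).Nonempty}
        ≤ (Measure.pi fun _ : Fin n => P) (⋃ i, Function.eval i ⁻¹' {p | f θ p.1 ≠ p.2}) := by
          refine measure_mono fun s hs => ?_
          by_contra hcon
          exact hs ⟨θ, by simpa [versionSpace] using hcon⟩
      _ ≤ ∑ i : Fin n, (Measure.pi fun _ : Fin n => P)
            (Function.eval i ⁻¹' {p | f θ p.1 ≠ p.2}) := measure_iUnion_fintype_le _ _
      _ = n * errP P (f θ) := by
          rw [Finset.sum_congr rfl fun i _ => (measurePreserving_eval (fun _ : Fin n => P)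
            i).measure_preimage hm.nullMeasurableSet]
          simp [errP]
  have hinf : ⨅ θ, errP P (f θ) = 0 := by
    rw [← hP, iInf_range]
  have hne : Nonempty Θ := by
    by_contra h
    rw [not_nonempty_iff] at h
    rw [iInf_of_empty] at hinf
    exact ENNReal.top_ne_zero hinf
  rw [ae_iff, ← nonpos_iff_eq_zero]
  calc (Measure.pi fun _ : Fin n => P) {s | ¬ (versionSpace f s).Nonempty}
      ≤ ⨅ θ, n * errP P (f θ) := le_iInf hle
    _ = n * ⨅ θ, errP P (f θ) := (ENNReal.mul_iInf' (by simp) fun _ => hne).symm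
    _ ≤ 0 := by simp [hinf]

theorem pi_add_le_mul {Z : Type*} [MeasurableSpace Z] (P : Measure Z) [SigmaFinite P] {m n : ℕ}
    {A : Set (Fin (m + n) → Z)} {B : Set (Fin m → Z)} {C : Set (Fin n → Z)}
    (h : ∀ s ∈ A, (fun i => s (Fin.castAdd n i)) ∈ B ∧ (fun i => s (Fin.natAdd m i)) ∈ C) :
    (Measure.pi fun _ : Fin (m + n) => P) A ≤
      (Measure.pi fun _ : Fin m => P) B * (Measure.pi fun _ : Fin n => P) C := by
  have h1 := measurePreserving_piCongrLeft (fun _ : Fin m ⊕ Fin n => P) finSumFinEquiv.symm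
  have h2 := measurePreserving_sumPiEquivProdPi (fun _ : Fin m ⊕ Fin n => P)
  have h3 := h2.comp h1
  rw [← Measure.prod_prod, ← h3.map_eq]
  refine (measure_mono ?_).trans (Measure.le_map_apply h3.measurable.aemeasurable _)
  intro s hs
  obtain ⟨hB, hC⟩ := h s hs
  refine ⟨?_, ?_⟩
  · convert hB using 2 with i
    have := Equiv.piCongrLeft_apply_apply (fun _ => Z) finSumFinEquiv.symm s (Fin.castAdd n i)
    rwa [finSumFinEquiv_symm_apply_castAdd] at this
  · convert hC using 2 with i
    have := Equiv.piCongrLeft_apply_apply (fun _ => Z) finSumFinEquiv.symm s (Fin.natAdd m i)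
    rwa [finSumFinEquiv_symm_apply_natAdd] at this

theorem exists_le_exp_of_submultiplicative {q : ℕ → ℝ≥0∞} (hq : ∀ n, q n ≤ 1)
    (hmul : ∀ m n, q (m + n) ≤ q m * q n) {n₀ : ℕ} (hn₀ : q n₀ < 1) :
    ∃ C > (0 : ℝ), ∃ c > (0 : ℝ), ∀ n : ℕ, q n ≤ ENNReal.ofReal (C * Real.exp (-c * n)) := by
  have hk : q (n₀ + 1) < 1 :=
    (hmul _ _).trans_lt ((mul_le_mul_right (hq 1) _).trans_lt (by simpa using hn₀))
  obtain ⟨ρ, hρq, hρ1⟩ := exists_between hk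
  have hρ0 : 0 < ρ.toReal := ENNReal.toReal_pos (bot_le.trans_lt hρq).ne' (hρ1.trans (by simp)).ne
  have hρ1' : ρ.toReal < 1 := by
    simpa using (ENNReal.toReal_lt_toReal (hρ1.trans (by simp)).ne (by simp)).2 hρ1
  have hlog : Real.log ρ.toReal < 0 := Real.log_neg hρ0 hρ1'
  set N := n₀ + 1 with hN
  have hpow : ∀ j r, q (N * j + r) ≤ ρ ^ j := by
    intro j r
    induction j with
    | zero => simpa using hq r
    | succ j ih =>
      rw [show N * (j + 1) + r = N + (N * j + r) by ring, pow_succ']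
      exact (hmul _ _).trans (mul_le_mul' hρq.le ih)
  have hN0 : (0 : ℝ) < N := by positivity
  refine ⟨ρ.toReal⁻¹, by positivity, -Real.log ρ.toReal / N, by
    apply _root_.div_pos <;> linarith, fun n => ?_⟩
  have h := hpow (n / N) (n % N)
  rw [Nat.div_add_mod] at h
  refine h.trans ?_
  rw [← ENNReal.ofReal_toReal (hρ1.trans (by simp)).ne, ← ENNReal.ofReal_pow hρ0.le]
  refine ENNReal.ofReal_le_ofReal ?_
  rw [ENNReal.toReal_ofReal hρ0.le]
  nth_rw 1 2 [← Real.exp_log hρ0]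
  rw [← Real.exp_nat_mul, ← Real.exp_neg, ← Real.exp_add, Real.exp_le_exp]
  have hdiv : (n : ℝ) / N ≤ (n / N : ℕ) + 1 := by
    have := Nat.lt_floor_add_one ((n : ℝ) / N)
    rw [Nat.floor_div_natCast, Nat.floor_natCast] at this
    exact this.le
  have : -(-Real.log ρ.toReal / N) * n = Real.log ρ.toReal * (n / N) := by
    field_simp
  rw [this]
  nlinarith

/-- If almost every sample leaves ordinal Littlestone dimension at least `α`, then the standard
optimal algorithm makes almost surely no error once the dimension is exactly `α`. -/
theorem ae_errP_soaPredict_eq_zero {Θ X : Type*} [MeasurableSpace Θ] [MeasurableSpace X]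
    {f : Θ → X → Bool} (hf : Measurable (Function.uncurry f)) {P : Measure (X × Bool)}
    [IsProbabilityMeasure P] (hP : Realizable (range f) P) {α β : Ordinal.{0}} (hαβ : α ≤ β)
    {n : ℕ} (hα : ∀ᵐ s ∂(Measure.pi fun _ : Fin (n + 1) => P),
      ∀ γ < α, LittlestoneRankGE f γ (versionSpace f s)) :
    ∀ᵐ s ∂(Measure.pi fun _ : Fin n => P), ¬ LittlestoneRankGE f α (versionSpace f s) →
      errP P (soaPredict f β (versionSpace f s)) = 0 := by
  have h1 := ((measurePreserving_piFinSuccAbove (fun _ : Fin (n + 1) => P) 0).symm _).comp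
    (Measure.measurePreserving_swap (μ := Measure.pi fun _ : Fin n => P) (ν := P))
  have h2 : ∀ᵐ q ∂((Measure.pi fun _ : Fin n => P).prod P),
      ∀ γ < α, LittlestoneRankGE f γ (versionSpace f (Fin.cons q.2 q.1 : Fin (n + 1) → X × Bool)) := by
    filter_upwards [h1.quasiMeasurePreserving.ae hα] with q hq
    have heq : ((MeasurableEquiv.piFinSuccAbove (fun _ : Fin (n + 1) => X × Bool) 0).symm ∘
        Prod.swap) q = (Fin.cons q.2 q.1 : Fin (n + 1) → X × Bool) := by
      simp [MeasurableEquiv.piFinSuccAbove, Fin.consEquiv]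
    rwa [← heq]
  filter_upwards [Measure.ae_ae_of_ae_prod h2, ae_versionSpace_nonempty hf hP n] with s hs hne hsα
  refine measure_mono_null (fun z hz => ?_) (ae_iff.1 hs)
  obtain ⟨γ, hγ, h⟩ := exists_lt_not_littlestoneRankGE_of_soaPredict_ne hαβ hne hsα hz
  simp only [mem_ofPred_eq, not_forall]
  exact ⟨γ, hγ, by rwa [versionSpace_cons]⟩

theorem exists_eventually_correct_of_not_hasInfiniteLittlestoneTree {X : Type*}
    [TopologicalSpace X] [PolishSpace X] [MeasurableSpace X] [BorelSpace X] {ℋ : Set (X → Bool)}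
    (hmeas : MeasurableClass X ℋ) (hT : ¬ HasInfiniteLittlestoneTree ℋ) :
    ∃ A : LearningAlgorithm X, ∀ P : Measure (X × Bool), IsProbabilityMeasure P → Realizable ℋ P →
      ∃ C > (0 : ℝ), ∃ c > (0 : ℝ), ∀ n : ℕ,
        (Measure.pi fun _ : Fin n => P) {s : Fin n → X × Bool | 0 < errP P (A.H n s)} ≤
          ENNReal.ofReal (C * Real.exp (-c * n)) := by
  obtain ⟨⟨Θ, f, hf, rfl⟩⟩ := hmeas
  obtain ⟨β, hβ, hβf⟩ := exists_lt_omega_one_not_littlestoneRankGE hf hT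
  refine ⟨soaAlgorithm hf hβ, fun P _ hP => ?_⟩
  have hβ0 : ∃ n, (Measure.pi fun _ : Fin n => P)
      {s | ¬ LittlestoneRankGE f β (versionSpace f s)} ≠ 0 := by
    refine ⟨0, ?_⟩
    have : {s : Fin 0 → X × Bool | ¬ LittlestoneRankGE f β (versionSpace f s)} = Set.univ :=
      eq_univ_of_forall fun s h => hβf (LittlestoneRankGE.mono h (subset_univ _))
    simp [this]
  obtain ⟨α, ⟨n₀, hn₀⟩, hmin⟩ := WellFounded.has_min (wellFounded_lt (α := Ordinal.{0}))
    {α | ∃ n, (Measure.pi fun _ : Fin n => P)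
      {s | ¬ LittlestoneRankGE f α (versionSpace f s)} ≠ 0} ⟨β, hβ0⟩
  have hαβ : α ≤ β := not_lt.1 (hmin β hβ0)
  have hα1 : α < ω₁ := hαβ.trans_lt hβ
  have hae : ∀ n, ∀ᵐ s ∂(Measure.pi fun _ : Fin n => P),
      ∀ γ < α, LittlestoneRankGE f γ (versionSpace f s) := by
    intro n
    have := Ordinal.countable_Iio_of_lt_omega_one hα1
    have h : ∀ᵐ s ∂(Measure.pi fun _ : Fin n => P),
        ∀ γ : Iio α, LittlestoneRankGE f γ (versionSpace f s) := by
      refine ae_all_iff.2 fun γ => ?_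
      rw [ae_iff]
      by_contra hγ
      exact hmin γ ⟨n, hγ⟩ γ.2
    filter_upwards [h] with s hs γ hγ using hs ⟨γ, hγ⟩
  have hlt : (Measure.pi fun _ : Fin n₀ => P) {s | LittlestoneRankGE f α (versionSpace f s)} < 1 := by
    have hm := (analyticSet_setOf_littlestoneRankGE_versionSpace hf hα1 n₀).nullMeasurableSet
      (Measure.pi fun _ : Fin n₀ => P)
    refine lt_of_le_of_ne prob_le_one fun h => hn₀ ?_
    exact (prob_compl_eq_zero_iff₀ hm).2 h
  obtain ⟨C, hC, c, hc, hq⟩ := exists_le_exp_of_submultiplicative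
    (q := fun n => (Measure.pi fun _ : Fin n => P) {s | LittlestoneRankGE f α (versionSpace f s)})
    (fun n => prob_le_one)
    (fun m n => pi_add_le_mul P fun s hs =>
      ⟨hs.mono fun θ hθ i => hθ _, hs.mono fun θ hθ i => hθ _⟩) hlt
  refine ⟨C, hC, c, hc, fun n => (measure_mono_ae ?_).trans (hq n)⟩
  filter_upwards [ae_errP_soaPredict_eq_zero hf hP hαβ (hae (n + 1))] with s hs herr
  by_contra hcon
  exact herr.ne' (hs hcon)

end UpperBound

section LowerBound

open MeasureTheory ProbabilityTheory Set Filter Topology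

/-- The geometric distribution on `ℕ` giving mass `2 ^ (-(k + 1))` to `k`. -/
noncomputable abbrev halfGeometric : Measure ℕ :=
  geometricMeasure ⟨1 / 2, by norm_num, by norm_num⟩

theorem halfGeometric_real_singleton (k : ℕ) : halfGeometric.real {k} = (1 / 2) ^ (k + 1) := by
  rw [geometricMeasure_real_singleton (by rw [← Subtype.coe_ne_coe]; norm_num)]
  norm_num [pow_succ]

theorem halfGeometric_real_Iio (k : ℕ) : halfGeometric.real (Iio k) = 1 - (1 / 2) ^ k := by
  rw [← Finset.coe_Iio, ← sum_measureReal_singleton]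
  simp only [halfGeometric_real_singleton, pow_succ, ← Finset.sum_mul]
  rw [Nat.Iio_eq_range, geom_sum_eq (by norm_num)]
  ring

theorem halfGeometric_real_Ici (k : ℕ) : halfGeometric.real (Ici k) = (1 / 2) ^ k := by
  rw [← compl_Iio, probReal_compl_eq_one_sub measurableSet_Iio, halfGeometric_real_Iio]
  ring

section GeometricSampling

variable {X : Type*} [MeasurableSpace X]

/-- The law of `z N`, where `N` is geometrically distributed. -/
noncomputable def geometricLaw (z : ℕ → X × Bool) : Measure (X × Bool) :=
  halfGeometric.map z

instance (z : ℕ → X × Bool) : IsProbabilityMeasure (geometricLaw z) :=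
  Measure.isProbabilityMeasure_map (Measurable.of_discrete).aemeasurable

theorem le_errP_geometricLaw {z : ℕ → X × Bool} {h : X → Bool} {k : ℕ}
    (hk : h (z k).1 ≠ (z k).2) :
    ENNReal.ofReal ((1 / 2) ^ (k + 1)) ≤ errP (geometricLaw z) h := by
  rw [← halfGeometric_real_singleton, ofReal_measureReal]
  refine le_trans (measure_mono ?_)
    (Measure.le_map_apply (Measurable.of_discrete (f := z)).aemeasurable _)
  simpa using hk

theorem errP_geometricLaw_le [MeasurableSingletonClass X] {z : ℕ → X × Bool} {h : X → Bool}
    {n : ℕ} (hn : ∀ j < n, h (z j).1 = (z j).2) :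
    errP (geometricLaw z) h ≤ ENNReal.ofReal ((1 / 2) ^ n) := by
  rw [← halfGeometric_real_Ici, ofReal_measureReal]
  have hm : MeasurableSet (z '' Iio n)ᶜ := ((finite_Iio n).image z).measurableSet.compl
  calc errP (geometricLaw z) h ≤ geometricLaw z (z '' Iio n)ᶜ := by
        refine measure_mono ?_
        rintro p hp ⟨j, hj, rfl⟩
        exact hp (hn j hj)
    _ = halfGeometric (z ⁻¹' (z '' Iio n)ᶜ) :=
        Measure.map_apply Measurable.of_discrete hm
    _ ≤ halfGeometric (Ici n) := by
        refine measure_mono fun j hj => ?_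
        by_contra hlt
        exact hj ⟨j, mem_Iio.2 (not_le.1 hlt), rfl⟩

theorem realizable_geometricLaw [MeasurableSingletonClass X] {ℋ : Set (X → Bool)}
    {z : ℕ → X × Bool} (hz : ∀ n, ∃ h ∈ ℋ, ∀ j < n, h (z j).1 = (z j).2) :
    Realizable ℋ (geometricLaw z) := by
  have hlim : Tendsto (fun n : ℕ => ENNReal.ofReal ((1 / 2 : ℝ) ^ n)) atTop (𝓝 0) := by
    rw [← ENNReal.ofReal_zero]
    exact ENNReal.tendsto_ofReal
      (tendsto_pow_atTop_nhds_zero_of_lt_one (by norm_num) (by norm_num))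
  refine le_antisymm (ge_of_tendsto' hlim fun n => ?_) bot_le
  obtain ⟨h, hh, hn⟩ := hz n
  exact (iInf₂_le h hh).trans (errP_geometricLaw_le hn)

theorem pi_halfGeometric_le (z : ℕ → X × Bool) {n : ℕ} (T : Set (Fin n → ℕ)) :
    (Measure.pi fun _ => halfGeometric) T ≤
      (Measure.pi fun _ : Fin n => geometricLaw z) ((fun t i => z (t i)) '' T) := by
  have : ∀ _ : Fin n, SigmaFinite (halfGeometric.map z) := fun _ =>
    inferInstanceAs (SigmaFinite (geometricLaw z))
  unfold geometricLaw
  rw [← Measure.pi_map_pi fun _ => (Measurable.of_discrete (f := z)).aemeasurable]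
  exact Measure.le_map_apply_image (Measurable.of_discrete).aemeasurable _

theorem pi_halfGeometric_le_measure_errP_pos {z : ℕ → X × Bool} (A : LearningAlgorithm X)
    {n k : ℕ} {T : Set (Fin n → ℕ)}
    (hT : ∀ t ∈ T, A.H n (fun i => z (t i)) (z k).1 ≠ (z k).2) :
    (Measure.pi fun _ => halfGeometric) T ≤
      (Measure.pi fun _ : Fin n => geometricLaw z) {s | 0 < errP (geometricLaw z) (A.H n s)} := by
  refine (pi_halfGeometric_le z T).trans (measure_mono ?_)
  rintro _ ⟨t, ht, rfl⟩
  exact (ENNReal.ofReal_pos.2 (by positivity)).trans_le (le_errP_geometricLaw (hT t ht))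

theorem mul_pi_halfGeometric_le_expErr [MeasurableSingletonClass X] {z : ℕ → X × Bool}
    (A : LearningAlgorithm X) {n k : ℕ} {T : Set (Fin n → ℕ)}
    (hT : ∀ t ∈ T, A.H n (fun i => z (t i)) (z k).1 ≠ (z k).2) :
    ENNReal.ofReal ((1 / 2) ^ (k + 1)) * (Measure.pi fun _ => halfGeometric) T ≤
      expErr (geometricLaw z) A n := by
  have hm : MeasurableSet ((fun t i => z (t i)) '' T : Set (Fin n → X × Bool)) :=
    (T.to_countable.image _).measurableSet
  calc _ ≤ ENNReal.ofReal ((1 / 2) ^ (k + 1)) *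
        (Measure.pi fun _ : Fin n => geometricLaw z) ((fun t i => z (t i)) '' T) := by
        gcongr
        exact pi_halfGeometric_le z T
    _ = ∫⁻ _ in (fun t i => z (t i)) '' T, ENNReal.ofReal ((1 / 2) ^ (k + 1))
          ∂(Measure.pi fun _ : Fin n => geometricLaw z) := (setLIntegral_const _ _).symm
    _ ≤ ∫⁻ s in (fun t i => z (t i)) '' T, errP (geometricLaw z) (A.H n s)
          ∂(Measure.pi fun _ : Fin n => geometricLaw z) := by
        refine setLIntegral_mono' hm ?_
        rintro _ ⟨t, ht, rfl⟩
        exact le_errP_geometricLaw (hT t ht)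
    _ ≤ expErr (geometricLaw z) A n := setLIntegral_le_lintegral _ _

end GeometricSampling

theorem expErr_le_measure_errP_pos {X : Type*} [MeasurableSpace X] (P : Measure (X × Bool))
    [IsProbabilityMeasure P] (A : LearningAlgorithm X) (n : ℕ) :
    expErr P A n ≤ (Measure.pi fun _ : Fin n => P) {s | 0 < errP P (A.H n s)} := by
  refine le_trans (lintegral_mono fun s => ?_) (lintegral_indicator_one_le _)
  by_cases hs : 0 < errP P (A.H n s)
  · rw [indicator_of_mem (show s ∈ {s | 0 < errP P (A.H n s)} from hs)]
    exact prob_le_one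
  · simp [not_lt.1 hs |> nonpos_iff_eq_zero.1]

theorem exists_branch_of_choice (g : List Bool → Bool) :
    ∃ y : ℕ → Bool, ∀ k, y k = g (List.ofFn fun i : Fin k => y i) := by
  let L : ℕ → List Bool := fun n => Nat.rec [] (fun _ l => l ++ [g l]) n
  refine ⟨fun n => g (L n), fun k => congrArg g ?_⟩
  induction k with
  | zero => simp [L]
  | succ k ih =>
    rw [List.ofFn_succ_last]
    exact congrArg₂ (fun l b => l ++ [b]) ih rfl

theorem learnableAtRate_exp_of_eventually_correct {X : Type*} [MeasurableSpace X]
    {ℋ : Set (X → Bool)} (h : ∃ A : LearningAlgorithm X,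
      ∀ P : Measure (X × Bool), IsProbabilityMeasure P → Realizable ℋ P →
        ∃ C > (0 : ℝ), ∃ c > (0 : ℝ), ∀ n : ℕ,
          (Measure.pi fun _ : Fin n => P) {s : Fin n → X × Bool | 0 < errP P (A.H n s)} ≤
            ENNReal.ofReal (C * Real.exp (-c * n))) :
    LearnableAtRate ℋ (fun n => Real.exp (-(n : ℝ))) := by
  obtain ⟨A, hA⟩ := h
  refine ⟨A, fun P hP hr => ?_⟩
  obtain ⟨C, hC, c, hc, hn⟩ := hA P hP hr
  refine ⟨C * Real.exp 1, by positivity, c, hc, fun n => ?_⟩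
  refine (expErr_le_measure_errP_pos P A n).trans ((hn n).trans (ENNReal.ofReal_le_ofReal ?_))
  rw [mul_assoc, ← Real.exp_add]
  have := (Nat.ceil_lt_add_one (show (0 : ℝ) ≤ c * n by positivity)).le
  gcongr
  linarith

/-- Two concepts which agree at one point and disagree at another one. -/
theorem exists_agree_disagree {X : Type*} {ℋ : Set (X → Bool)} (hcard : 2 < ℋ.encard) :
    ∃ h₁ ∈ ℋ, ∃ h₂ ∈ ℋ, ∃ x x', h₁ x = h₂ x ∧ h₁ x' ≠ h₂ x' := by
  by_contra! hcon
  have hne : ∀ h₁ ∈ ℋ, ∀ h₂ ∈ ℋ, h₁ ≠ h₂ → ∀ x, h₁ x ≠ h₂ x := by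
    intro h₁ m₁ h₂ m₂ hd x hx
    exact hd (funext fun x' => hcon h₁ m₁ h₂ m₂ x x' hx)
  obtain ⟨h₁, m₁⟩ : ℋ.Nonempty := by
    rw [nonempty_iff_ne_empty]
    rintro rfl
    simp at hcard
  have hsub : ℋ ⊆ {h₁, fun x => !h₁ x} := by
    intro h m
    by_cases hd : h = h₁
    · exact Or.inl hd
    · exact Or.inr (funext fun x => Bool.eq_not.2 (hne h m h₁ m₁ hd x))
  exact absurd ((encard_le_encard hsub).trans ((encard_insert_le _ _).trans_eq
    (by rw [encard_singleton, one_add_one_eq_two]))) (not_le.2 hcard)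

theorem notLearnableFasterThan_exp {X : Type*} [MeasurableSpace X] [MeasurableSingletonClass X]
    {ℋ : Set (X → Bool)} (hcard : 2 < ℋ.encard) :
    NotLearnableFasterThan ℋ (fun n => Real.exp (-(n : ℝ))) := by
  intro A
  obtain ⟨h₁, m₁, h₂, m₂, x, x', hx, hx'⟩ := exists_agree_disagree hcard
  let z : (X → Bool) → ℕ → X × Bool := fun h k => if k = 0 then (x, h x) else (x', h x')
  have hreal : ∀ h ∈ ℋ, Realizable ℋ (geometricLaw (z h)) := fun h m =>
    realizable_geometricLaw fun n => ⟨h, m, fun j _ => by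
      rcases eq_or_ne j 0 with rfl | hj <;> simp [z, *]⟩
  have hbound : ∀ h n, A.H n (fun _ => (x, h x)) x' ≠ h x' →
      ENNReal.ofReal (1 / 4 * Real.exp (-(⌈1 * (n : ℝ)⌉₊ : ℝ))) ≤
        expErr (geometricLaw (z h)) A n := by
    intro h n hn
    refine le_trans ?_ (mul_pi_halfGeometric_le_expErr A (z := z h) (k := 1) (T := {0}) ?_)
    · have h0 : halfGeometric {0} = ENNReal.ofReal (1 / 2) := by
        rw [← ofReal_measureReal, halfGeometric_real_singleton]
        norm_num
      simp only [Measure.pi_singleton, Pi.zero_apply, h0, Finset.prod_const, Finset.card_univ,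
        Fintype.card_fin]
      rw [← ENNReal.ofReal_pow (by norm_num), ← ENNReal.ofReal_mul (by positivity), one_mul,
        Nat.ceil_natCast]
      refine ENNReal.ofReal_le_ofReal (mul_le_mul (by norm_num) ?_ (Real.exp_pos _).le
        (by norm_num))
      rw [← mul_neg_one, Real.exp_nat_mul]
      refine pow_le_pow_left₀ (Real.exp_pos _).le ?_ n
      rw [Real.exp_neg, one_div]
      exact inv_anti₀ two_pos (by linarith [Real.add_one_le_exp 1])
    · rintro _ rfl
      simpa [z] using hn
  have hinf : ({n | A.H n (fun _ => (x, h₁ x)) x' ≠ h₁ x'} ∪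
      {n | A.H n (fun _ => (x, h₂ x)) x' ≠ h₂ x'}).Infinite := by
    convert infinite_univ (α := ℕ)
    refine eq_univ_of_forall fun n => ?_
    by_contra! hn
    simp only [mem_union, mem_ofPred_eq, not_or, not_not] at hn
    exact hx' (by rw [← hn.1, ← hn.2, hx])
  rcases infinite_union.1 hinf with hi | hi
  · exact ⟨_, inferInstance, hreal h₁ m₁, 1 / 4, by norm_num, 1, one_pos,
      hi.mono fun n => hbound h₁ n⟩
  · exact ⟨_, inferInstance, hreal h₂ m₂, 1 / 4, by norm_num, 1, one_pos,
      hi.mono fun n => hbound h₂ n⟩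

/-- Given an infinite Littlestone tree, every learning algorithm fails, on some branch, to predict
the label at depth `k` from `2 ^ k / 2` samples of smaller depth, for all `k`. -/
theorem exists_hard_sequence_of_hasInfiniteLittlestoneTree {X : Type*} [MeasurableSpace X]
    {ℋ : Set (X → Bool)} (hT : HasInfiniteLittlestoneTree ℋ) (A : LearningAlgorithm X) :
    ∃ z : ℕ → X × Bool, (∀ n, ∃ h ∈ ℋ, ∀ j < n, h (z j).1 = (z j).2) ∧
      ∀ k, ENNReal.ofReal (1 / 4) ≤ (Measure.pi fun _ => halfGeometric)
        {t : Fin (2 ^ k / 2) → ℕ | A.H _ (fun i => z (t i)) (z k).1 ≠ (z k).2} := by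
  obtain ⟨x, hx⟩ := hT
  let w : List Bool → ℕ → X × Bool := fun l j => (x (l.take j), l.getD j false)
  let W : ∀ m : ℕ, List Bool → Bool → Set (Fin m → ℕ) := fun m l b =>
    {t | (∀ i, t i < l.length) ∧ A.H m (fun i => w l (t i)) (x l) ≠ b}
  have hW : ∀ l : List Bool, ∃ b, ∀ m, m = 2 ^ l.length / 2 →
      ENNReal.ofReal (1 / 4) ≤ (Measure.pi fun _ => halfGeometric) (W m l b) := by
    intro l
    by_contra! hcon
    obtain ⟨_, rfl, ht⟩ := hcon true
    obtain ⟨_, rfl, hf⟩ := hcon false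
    refine (ENNReal.add_lt_add ht hf).not_ge ?_
    rw [← ENNReal.ofReal_add (by norm_num) (by norm_num)]
    calc ENNReal.ofReal (1 / 4 + 1 / 4)
        ≤ (Measure.pi fun _ : Fin (2 ^ l.length / 2) => halfGeometric)
            (univ.pi fun _ => Iio l.length) := by
          have h0 : halfGeometric (Iio l.length) = ENNReal.ofReal (1 - (1 / 2) ^ l.length) := by
            rw [← ofReal_measureReal, halfGeometric_real_Iio]
          have h1 : ((1 : ℝ) / 2) ^ l.length ≤ 1 := pow_le_one₀ (by norm_num) (by norm_num)
          rw [Measure.pi_pi, Finset.prod_const, Finset.card_univ, Fintype.card_fin, h0,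
            ← ENNReal.ofReal_pow (by linarith)]
          refine ENNReal.ofReal_le_ofReal ?_
          have h2 := one_add_mul_le_pow (a := -((1 : ℝ) / 2) ^ l.length) (by linarith)
            (2 ^ l.length / 2)
          rw [← sub_eq_add_neg] at h2
          refine le_trans ?_ h2
          have h3 : ((2 ^ l.length / 2 : ℕ) : ℝ) ≤ 2 ^ l.length / 2 := by
            simpa using Nat.cast_div_le (α := ℝ) (m := 2 ^ l.length) (n := 2)
          have h4 : (2 : ℝ) ^ l.length * (1 / 2) ^ l.length = 1 := by
            rw [← mul_pow]
            norm_num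
          have h5 : (0 : ℝ) ≤ (1 / 2) ^ l.length := by positivity
          nlinarith
      _ ≤ _ := by
          refine (measure_mono fun t ht => ?_).trans (measure_union_le _ _)
          have ht' : ∀ i, t i < l.length := fun i => ht i (mem_univ i)
          cases hb : A.H _ (fun i => w l (t i)) (x l)
          · exact Or.inl ⟨ht', by simp [hb]⟩
          · exact Or.inr ⟨ht', by simp [hb]⟩
  choose g hg using hW
  obtain ⟨y, hy⟩ := exists_branch_of_choice g
  refine ⟨fun k => (x (List.ofFn fun i : Fin k => y i), y k), fun n => ?_, fun k => ?_⟩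
  · obtain ⟨h, hh, hn⟩ := hx y n
    exact ⟨h, hh, fun j hj => hn j hj.le⟩
  · refine (hg (List.ofFn fun i : Fin k => y i) (2 ^ k / 2) (by simp)).trans (measure_mono ?_)
    rintro t ⟨htk, ht⟩
    have hw : ∀ i, w (List.ofFn fun i : Fin k => y i) (t i) =
        (x (List.ofFn fun j : Fin (t i) => y j), y (t i)) := by
      intro i
      have hi : t i < k := by simpa using htk i
      refine Prod.ext ?_ ?_
      · refine congrArg x (List.ext_getElem ?_ fun j h1 h2 => ?_)
        · simpa using hi.le
        · simp
      · simp [w, hi]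
    simp only [hw, ← hy] at ht
    exact ht

theorem not_learnableAtRate_exp_of_hasInfiniteLittlestoneTree {X : Type*} [MeasurableSpace X]
    [MeasurableSingletonClass X] {ℋ : Set (X → Bool)} (hT : HasInfiniteLittlestoneTree ℋ) :
    ¬ LearnableAtRate ℋ (fun n => Real.exp (-(n : ℝ))) := by
  rintro ⟨A, hA⟩
  obtain ⟨z, hz, hzA⟩ := exists_hard_sequence_of_hasInfiniteLittlestoneTree hT A
  obtain ⟨C, hC, c, hc, hn⟩ := hA _ inferInstance (realizable_geometricLaw hz)
  have hle : ∀ j : ℕ, 1 / 16 ≤ C / c * ((c * 2 ^ j) ^ 1 * Real.exp (-(c * 2 ^ j))) := by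
    intro j
    have h1 := (mul_le_mul_right (hzA (j + 1)) (ENNReal.ofReal ((1 / 2) ^ (j + 1 + 1)))).trans
      ((mul_pi_halfGeometric_le_expErr A fun t ht => ht).trans (hn _))
    rw [← ENNReal.ofReal_mul (by positivity), ENNReal.ofReal_le_ofReal_iff (by positivity)] at h1
    have h2 : Real.exp (-(⌈c * ((2 ^ (j + 1) / 2 : ℕ) : ℝ)⌉₊ : ℝ)) ≤ Real.exp (-(c * 2 ^ j)) := by
      refine Real.exp_le_exp.2 (neg_le_neg ?_)
      rw [pow_succ, Nat.mul_div_cancel _ two_pos]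
      push_cast
      exact Nat.le_ceil _
    have h3 := h1.trans (mul_le_mul_of_nonneg_left h2 hC.le)
    have h4 : C / c * ((c * 2 ^ j) ^ 1 * Real.exp (-(c * 2 ^ j))) =
        2 ^ j * (C * Real.exp (-(c * 2 ^ j))) := by
      field_simp
    have h5 : (2 : ℝ) ^ j * ((1 / 2) ^ (j + 1 + 1) * (1 / 4)) = 1 / 16 := by
      rw [pow_succ, pow_succ, one_div, inv_pow]
      field_simp
      norm_num
    rw [h4, ← h5]
    gcongr
  have hlim : Tendsto (fun j : ℕ => C / c * ((c * 2 ^ j) ^ 1 * Real.exp (-(c * 2 ^ j)))) atTop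
      (𝓝 (C / c * 0)) :=
    ((Real.tendsto_pow_mul_exp_neg_atTop_nhds_zero 1).comp
      ((tendsto_pow_atTop_atTop_of_one_lt (one_lt_two : (1 : ℝ) < 2)).const_mul_atTop hc)).const_mul _
  have := ge_of_tendsto' hlim hle
  norm_num at this

theorem not_hasInfiniteLittlestoneTree_of_tendsto {X : Type*} [MeasurableSpace X]
    [MeasurableSingletonClass X] {ℋ : Set (X → Bool)} (A : LearningAlgorithm X)
    (hA : ∀ P : Measure (X × Bool), IsProbabilityMeasure P → Realizable ℋ P →
      Tendsto (fun n : ℕ => (Measure.pi fun _ : Fin n => P)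
        {s : Fin n → X × Bool | 0 < errP P (A.H n s)}) atTop (𝓝 0)) :
    ¬ HasInfiniteLittlestoneTree ℋ := by
  intro hT
  obtain ⟨z, hz, hzA⟩ := exists_hard_sequence_of_hasInfiniteLittlestoneTree hT A
  have hlim : Tendsto (fun k : ℕ => 2 ^ k / 2) atTop atTop :=
    (Nat.tendsto_div_const_atTop two_ne_zero).comp (tendsto_pow_atTop_atTop_of_one_lt one_lt_two)
  have := ge_of_tendsto' ((hA _ inferInstance (realizable_geometricLaw hz)).comp hlim)
    fun k => (hzA k).trans (pi_halfGeometric_le_measure_errP_pos A fun t ht => ht)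
  norm_num at this

end LowerBound

/-- **Proposition 4.7.** For a measurable concept class `ℋ` on a Polish space with `|ℋ| > 2`, the
following are equivalent: (1) `ℋ` is learnable with optimal rate `e^{-n}`; (2) `ℋ` has no
infinite Littlestone tree; (3) there is an "eventually correct" learning algorithm, i.e. one with
`P^{⊗n}{er_P(ĥ_n) > 0} → 0` for every realizable `P`; (4) there is an eventually correct learning
algorithm with exponential rate: `P^{⊗n}{er_P(ĥ_n) > 0} ≤ C e^{-cn}`. -/
theorem exponential_rate_equivalences
    (𝒳 : Type*) [TopologicalSpace 𝒳] [PolishSpace 𝒳] [MeasurableSpace 𝒳] [BorelSpace 𝒳]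
    (ℋ : Set (𝒳 → Bool)) (hmeas : MeasurableClass 𝒳 ℋ) (hcard : 2 < ℋ.encard) :
    (LearnableWithOptimalRate ℋ (fun n => Real.exp (-(n : ℝ))) ↔
        ¬ HasInfiniteLittlestoneTree ℋ) ∧
    (¬ HasInfiniteLittlestoneTree ℋ ↔
        ∃ A : LearningAlgorithm 𝒳,
          ∀ P : MeasureTheory.Measure (𝒳 × Bool),
            MeasureTheory.IsProbabilityMeasure P → Realizable ℋ P →
              Filter.Tendsto
                (fun n : ℕ => (MeasureTheory.Measure.pi fun _ : Fin n => P)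
                  {s : Fin n → 𝒳 × Bool | 0 < errP P (A.H n s)})
                Filter.atTop (nhds 0)) ∧
    ((∃ A : LearningAlgorithm 𝒳,
          ∀ P : MeasureTheory.Measure (𝒳 × Bool),
            MeasureTheory.IsProbabilityMeasure P → Realizable ℋ P →
              Filter.Tendsto
                (fun n : ℕ => (MeasureTheory.Measure.pi fun _ : Fin n => P)
                  {s : Fin n → 𝒳 × Bool | 0 < errP P (A.H n s)})
                Filter.atTop (nhds 0)) ↔
        ∃ A : LearningAlgorithm 𝒳,
          ∀ P : MeasureTheory.Measure (𝒳 × Bool),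
            MeasureTheory.IsProbabilityMeasure P → Realizable ℋ P →
              ∃ C > (0 : ℝ), ∃ c > (0 : ℝ), ∀ n : ℕ,
                (MeasureTheory.Measure.pi fun _ : Fin n => P)
                    {s : Fin n → 𝒳 × Bool | 0 < errP P (A.H n s)}
                  ≤ ENNReal.ofReal (C * Real.exp (-c * n))) := by
  have h24 := exists_eventually_correct_of_not_hasInfiniteLittlestoneTree hmeas
  have h34 : ∀ {P : MeasureTheory.Measure (𝒳 × Bool)} {A : LearningAlgorithm 𝒳},
      (∃ C > (0 : ℝ), ∃ c > (0 : ℝ), ∀ n : ℕ,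
        (MeasureTheory.Measure.pi fun _ : Fin n => P)
          {s : Fin n → 𝒳 × Bool | 0 < errP P (A.H n s)} ≤ ENNReal.ofReal (C * Real.exp (-c * n))) →
      Filter.Tendsto
        (fun n : ℕ => (MeasureTheory.Measure.pi fun _ : Fin n => P)
          {s : Fin n → 𝒳 × Bool | 0 < errP P (A.H n s)}) Filter.atTop (nhds 0) := by
    rintro P A ⟨C, -, c, hc, h⟩
    refine tendsto_of_tendsto_of_tendsto_of_le_of_le tendsto_const_nhds ?_ (fun _ => bot_le) h
    have hexp := Real.tendsto_exp_atBot.comp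
      (tendsto_natCast_atTop_atTop.const_mul_atTop_of_neg (neg_lt_zero.2 hc))
    simpa using ENNReal.tendsto_ofReal (hexp.const_mul C)
  refine ⟨⟨fun h hT => not_learnableAtRate_exp_of_hasInfiniteLittlestoneTree hT h.1, fun hT =>
      ⟨learnableAtRate_exp_of_eventually_correct (h24 hT), notLearnableFasterThan_exp hcard⟩⟩,
    ⟨fun hT => ?_, fun ⟨A, hA⟩ => not_hasInfiniteLittlestoneTree_of_tendsto A hA⟩,
    fun ⟨A, hA⟩ => h24 (not_hasInfiniteLittlestoneTree_of_tendsto A hA), fun ⟨A, hA⟩ => ?_⟩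
  · obtain ⟨A, hA⟩ := h24 hT
    exact ⟨A, fun P hP hr => h34 (hA P hP hr)⟩
  · exact ⟨A, fun P hP hr => h34 (hA P hP hr)⟩
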